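/- arXiv:1811.10069 — 6 statements merged into one kernel-verified Lean document; each statement's English description precedes it below -/
import Mathlib

section
/- Let k be an algebraically closed field and a, b ∈ k. In the algebra C(a,b,1), for every n ≥ 0 the relation e_n·(z·x^n·z) = f_n·(z·x^{n+1}) + g_n·(x^{n+1}·z) + h_n·x^{n+2} holds, where e_n, f_n, g_n, h_n ∈ k are computed from the pair (a,b). -/
noncomputable section

open FreeAlgebra

/-- The generator `x` of the free algebra `k⟨x,z⟩`. -/
def Xf (k : Type*) [Field k] : FreeAlgebra k (Fin 2) := FreeAlgebra.ι k 0

/-- The generator `z` of the free algebra `k⟨x,z⟩`. -/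
def Zf (k : Type*) [Field k] : FreeAlgebra k (Fin 2) := FreeAlgebra.ι k 1

/-- The relation defining `C(a,b,c)`: `zx = a·x² + b·xz + c·z²`. -/
def Crel (k : Type*) [Field k] (a b c : k) :
    FreeAlgebra k (Fin 2) → FreeAlgebra k (Fin 2) → Prop := fun m n =>
  m = Zf k * Xf k ∧ n = a • (Xf k) ^ 2 + b • (Xf k * Zf k) + c • (Zf k) ^ 2

/-- The algebra `C(a,b,c) = k⟨x,z⟩/⟨zx - a·x² - b·xz - c·z²⟩`. -/
abbrev Calg (k : Type*) [Field k] (a b c : k) := RingQuot (Crel k a b c)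

/-- The image of `x` in `C(a,b,c)`. -/
def Cx (k : Type*) [Field k] (a b c : k) : Calg k a b c :=
  RingQuot.mkAlgHom k (Crel k a b c) (Xf k)

/-- The image of `z` in `C(a,b,c)`. -/
def Cz (k : Type*) [Field k] (a b c : k) : Calg k a b c :=
  RingQuot.mkAlgHom k (Crel k a b c) (Zf k)

/-- The pair of sequences `(e_n, f_n)` associated to parameters `a, b`. -/
def efPair {k : Type*} [Field k] (a b : k) : ℕ → k × k
  | 0 => (1, 1)
  | n + 1 => (b * (efPair a b n).1 + (efPair a b n).2,
              -a * (efPair a b n).1 + (efPair a b n).2)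

/-- The sequence `e_n(a,b)`. -/
def eSeq {k : Type*} [Field k] (a b : k) (n : ℕ) : k := (efPair a b n).1

/-- The sequence `f_n(a,b)`. -/
def fSeq {k : Type*} [Field k] (a b : k) (n : ℕ) : k := (efPair a b n).2

/-- The sequence `g_n(a,b) = (1-b)·e_n - f_n`. -/
def gSeq {k : Type*} [Field k] (a b : k) (n : ℕ) : k :=
  (1 - b) * eSeq a b n - fSeq a b n

/-- The sequence `h_n(a,b) = -a·e_n`. -/
def hSeq {k : Type*} [Field k] (a b : k) (n : ℕ) : k := -a * eSeq a b n

/-- The defining relation of `C(a,b,1)`, solved for `z²`. -/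
theorem Cz_mul_Cz {k : Type*} [Field k] (a b : k) :
    Cz k a b 1 * Cz k a b 1 =
      Cz k a b 1 * Cx k a b 1 - b • (Cx k a b 1 * Cz k a b 1) -
        a • (Cx k a b 1 * Cx k a b 1) := by
  have h : Cz k a b 1 * Cx k a b 1 =
      a • (Cx k a b 1 * Cx k a b 1) + b • (Cx k a b 1 * Cz k a b 1) +
        Cz k a b 1 * Cz k a b 1 := by
    simpa [pow_two, Cx, Cz] using
      RingQuot.mkAlgHom_rel k (s := Crel k a b 1) ⟨rfl, rfl⟩
  rw [h]
  module

/-- If `z² = zx - b·xz - a·x²`, then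
`e_n·(z x^n z) = f_n·(z x^{n+1}) + g_n·(x^{n+1} z) + h_n·x^{n+2}`. -/
theorem eSeq_smul_mul_pow_mul {k A : Type*} [Field k] [Ring A] [Algebra k A] {a b : k} {x z : A}
    (hz : z * z = z * x - b • (x * z) - a • (x * x)) (n : ℕ) :
    eSeq a b n • (z * x ^ n * z) =
      fSeq a b n • (z * x ^ (n + 1)) + gSeq a b n • (x ^ (n + 1) * z) +
        hSeq a b n • x ^ (n + 2) := by
  induction n with
  | zero =>
    simp only [eSeq, fSeq, gSeq, hSeq, efPair, pow_zero, mul_one, zero_add, pow_one, pow_two, hz]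
    module
  | succ n ih =>
    have mul_x := congrArg (· * x) ih
    have mul_z := congrArg (· * z) ih
    have left_z := congrArg (z * x ^ n * ·) hz
    have right_z := congrArg (x ^ (n + 1) * ·) hz
    have he : eSeq a b (n + 1) = b * eSeq a b n + fSeq a b n := rfl
    have hf : fSeq a b (n + 1) = -a * eSeq a b n + fSeq a b n := rfl
    simp only [gSeq, hSeq, he, hf] at mul_x mul_z ⊢
    simp only [add_mul, mul_sub, smul_mul_assoc, mul_smul_comm, pow_succ, mul_assoc]
      at mul_x mul_z left_z right_z ⊢
    linear_combination (norm := module) mul_x - mul_z + eSeq a b n • left_z -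
      ((1 - b) * eSeq a b n - fSeq a b n) • right_z

/-- In `C(a,b,1)`, the relation
`e_n·(z x^n z) = f_n·(z x^{n+1}) + g_n·(x^{n+1} z) + h_n·x^{n+2}` holds for all `n ≥ 0`. -/
theorem stmt1 {k : Type*} [Field k] [IsAlgClosed k] (a b : k) :
    ∀ n : ℕ,
      eSeq a b n • (Cz k a b 1 * (Cx k a b 1) ^ n * Cz k a b 1) =
        fSeq a b n • (Cz k a b 1 * (Cx k a b 1) ^ (n + 1)) +
          gSeq a b n • ((Cx k a b 1) ^ (n + 1) * Cz k a b 1) +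
          hSeq a b n • (Cx k a b 1) ^ (n + 2) := by
  exact eSeq_smul_mul_pow_mul (Cz_mul_Cz a b)
end
end

section
/- Let k be an algebraically closed field and a, b ∈ k. The family of elements (i,j) ↦ x^i·z^j (for i, j ≥ 0) is a k-vector-space basis of C(a,b,1) if and only if f_n ≠ 0 for all n ≥ 0, where f_n ∈ k is computed from the pair (a,b). -/
noncomputable section

open FreeAlgebra

namespace Calg

variable {k : Type*} [Field k]

lemma rel (a b c : k) : Cz k a b c * Cx k a b c =
    a • Cx k a b c ^ 2 + b • (Cx k a b c * Cz k a b c) + c • Cz k a b c ^ 2 := by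
  have h := RingQuot.mkAlgHom_rel k (s := Crel k a b c) ⟨rfl, rfl⟩
  simp only [map_mul, map_add, map_smul, map_pow] at h
  exact h

lemma exists_algHom {B : Type*} [Ring B] [Algebra k B] {a b c : k} {X Z : B}
    (h : Z * X = a • X ^ 2 + b • (X * Z) + c • Z ^ 2) :
    ∃ φ : Calg k a b c →ₐ[k] B, φ (Cx k a b c) = X ∧ φ (Cz k a b c) = Z := by
  refine ⟨RingQuot.liftAlgHom k ⟨FreeAlgebra.lift k ![X, Z], ?_⟩, ?_, ?_⟩
  · rintro _ _ ⟨rfl, rfl⟩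
    simpa [Xf, Zf] using h
  · simp [Cx, Xf]
  · simp [Cz, Zf]

/-- A subspace containing `1` and stable under right multiplication by both generators is
everything. -/
lemma eq_top_of_mul_mem {a b c : k} (W : Submodule k (Calg k a b c)) (h1 : 1 ∈ W)
    (hx : ∀ w ∈ W, w * Cx k a b c ∈ W) (hz : ∀ w ∈ W, w * Cz k a b c ∈ W) : W = ⊤ := by
  have key : ∀ y : FreeAlgebra k (Fin 2), ∀ w ∈ W, w * RingQuot.mkAlgHom k (Crel k a b c) y ∈ W := by
    intro y
    induction y using FreeAlgebra.induction with
    | grade0 r =>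
      intro w hw
      rw [AlgHom.commutes, ← Algebra.commutes, ← Algebra.smul_def]
      exact W.smul_mem r hw
    | grade1 i =>
      fin_cases i
      · exact hx
      · exact hz
    | mul p q hp hq =>
      intro w hw
      rw [map_mul, ← mul_assoc]
      exact hq _ (hp _ hw)
    | add p q hp hq =>
      intro w hw
      rw [map_add, mul_add]
      exact W.add_mem (hp _ hw) (hq _ hw)
  refine eq_top_iff.2 fun y _ => ?_
  obtain ⟨y, rfl⟩ := RingQuot.mkAlgHom_surjective k (Crel k a b c) y
  simpa using key y 1 h1

end Calg

section Sequences

variable {k : Type*} [Field k] (a b : k)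

lemma eSeq_zero : eSeq a b 0 = 1 := rfl

lemma fSeq_zero : fSeq a b 0 = 1 := rfl

lemma eSeq_succ (n : ℕ) : eSeq a b (n + 1) = b * eSeq a b n + fSeq a b n := rfl

lemma fSeq_succ (n : ℕ) : fSeq a b (n + 1) = -a * eSeq a b n + fSeq a b n := rfl

variable {a b}

lemma add_eq_zero_of_eSeq_fSeq_eq_zero {n : ℕ} (he : eSeq a b n = 0) (hf : fSeq a b n = 0) :
    a + b = 0 := by
  induction n with
  | zero => simp [eSeq_zero] at he
  | succ n ih =>
    rw [eSeq_succ] at he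
    rw [fSeq_succ] at hf
    have h : (a + b) * eSeq a b n = 0 := by linear_combination he - hf
    rcases mul_eq_zero.1 h with h | h
    · exact h
    · exact ih h (by simpa [h] using he)

lemma eSeq_fSeq_neg (a : k) (n : ℕ) :
    eSeq a (-a) n = (1 - a) ^ n ∧ fSeq a (-a) n = (1 - a) ^ n := by
  induction n with
  | zero => simp [eSeq_zero, fSeq_zero]
  | succ n ih =>
    rw [eSeq_succ, fSeq_succ, ih.1, ih.2]
    constructor <;> ring

lemma eq_one_of_eSeq_fSeq_eq_zero {n : ℕ} (he : eSeq a b n = 0) (hf : fSeq a b n = 0) :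
    a = 1 ∧ b = -1 := by
  obtain rfl : b = -a := by linear_combination add_eq_zero_of_eSeq_fSeq_eq_zero he hf
  rw [(eSeq_fSeq_neg a n).1] at he
  have h : 1 - a = 0 := eq_zero_of_pow_eq_zero he
  obtain rfl : a = 1 := by linear_combination -h
  simp

end Sequences

section Normal

variable {k A : Type*} [Field k] [Ring A] [Algebra k A] {a b : k} {x z : A}

lemma fSeq_smul_pow_mul_step (h : z * x = a • x ^ 2 + b • (x * z) + z ^ 2) {n : ℕ} {w : A}
    (hw : fSeq a b n • (z ^ (n + 1) * x) = eSeq a b n • z ^ (n + 2) + x * w) :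
    fSeq a b (n + 1) • (z ^ (n + 2) * x) =
      eSeq a b (n + 1) • z ^ (n + 3) + x * (a • (w * x) + b • (w * z)) := by
  have h1 : z ^ (n + 2) * x =
      a • (z ^ (n + 1) * x * x) + b • (z ^ (n + 1) * x * z) + z ^ (n + 3) := by
    rw [pow_succ z (n + 1), mul_assoc, h, mul_add, mul_add, mul_smul_comm, mul_smul_comm,
      ← pow_add, pow_two x, mul_assoc, mul_assoc]
  have h2 : fSeq a b n • (z ^ (n + 2) * x) =
      a • ((eSeq a b n • z ^ (n + 2) + x * w) * x) +
        b • ((eSeq a b n • z ^ (n + 2) + x * w) * z) + fSeq a b n • z ^ (n + 3) := by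
    rw [← hw, h1, smul_add, smul_add, smul_mul_assoc, smul_mul_assoc, smul_comm a, smul_comm b]
  have h3 : z ^ (n + 2) * z = z ^ (n + 3) := (pow_succ z (n + 2)).symm
  rw [fSeq_succ, eSeq_succ, add_smul, h2]
  simp only [add_mul, smul_mul_assoc, h3, mul_add, mul_smul_comm, mul_assoc]
  module

lemma fSeq_smul_pow_mul_zero (h : z * x = a • x ^ 2 + b • (x * z) + z ^ 2) :
    fSeq a b 0 • (z ^ (0 + 1) * x) = eSeq a b 0 • z ^ (0 + 2) + x * (a • x + b • z) := by
  simp only [fSeq_zero, eSeq_zero, one_smul, zero_add, pow_one, h, mul_add, mul_smul_comm,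
    pow_two x]
  abel

lemma exists_fSeq_smul_pow_mul (h : z * x = a • x ^ 2 + b • (x * z) + z ^ 2) (n : ℕ) :
    ∃ w : A, fSeq a b n • (z ^ (n + 1) * x) = eSeq a b n • z ^ (n + 2) + x * w := by
  induction n with
  | zero => exact ⟨_, fSeq_smul_pow_mul_zero h⟩
  | succ n ih =>
    obtain ⟨w, hw⟩ := ih
    exact ⟨_, fSeq_smul_pow_mul_step h hw⟩

/-- The span of the ordered monomials `x ^ i * z ^ j` of total degree `n`. -/
def orderedSpan (k : Type*) {A : Type*} [Field k] [Ring A] [Algebra k A] (x z : A) (n : ℕ) :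
    Submodule k A :=
  Submodule.span k ((fun p : ℕ × ℕ => x ^ p.1 * z ^ p.2) '' {p | p.1 + p.2 = n})

lemma pow_mul_pow_mem_orderedSpan (i j : ℕ) : x ^ i * z ^ j ∈ orderedSpan k x z (i + j) :=
  Submodule.subset_span ⟨(i, j), rfl, rfl⟩

lemma pow_mem_orderedSpan (n : ℕ) : z ^ n ∈ orderedSpan k x z n := by
  simpa using pow_mul_pow_mem_orderedSpan (k := k) (x := x) (z := z) 0 n

lemma mul_mem_orderedSpan_left {n : ℕ} {w : A} (hw : w ∈ orderedSpan k x z n) :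
    x * w ∈ orderedSpan k x z (n + 1) := by
  induction hw using Submodule.span_induction with
  | mem w hw =>
    obtain ⟨⟨i, j⟩, rfl, rfl⟩ := hw
    have := pow_mul_pow_mem_orderedSpan (k := k) (x := x) (z := z) (i + 1) j
    rw [pow_succ', mul_assoc, Nat.add_right_comm] at this
    exact this
  | zero => simp
  | add u v _ _ hu hv => rw [mul_add]; exact add_mem hu hv
  | smul r u _ hu => rw [mul_smul_comm]; exact Submodule.smul_mem _ r hu

lemma pow_mul_mem_orderedSpan {n : ℕ} {w : A} (i : ℕ) (hw : w ∈ orderedSpan k x z n) :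
    x ^ i * w ∈ orderedSpan k x z (i + n) := by
  induction i with
  | zero => simpa using hw
  | succ i ih =>
    rw [pow_succ', mul_assoc, Nat.add_right_comm]
    exact mul_mem_orderedSpan_left ih

/-- Right multiplication by `y` raises degrees of ordered monomials if it does so for `z ^ j`. -/
lemma mul_mem_orderedSpan_right {n : ℕ} {w y : A}
    (hy : ∀ j ≤ n, z ^ j * y ∈ orderedSpan k x z (j + 1)) (hw : w ∈ orderedSpan k x z n) :
    w * y ∈ orderedSpan k x z (n + 1) := by
  induction hw using Submodule.span_induction with
  | mem w hw =>
    obtain ⟨⟨i, j⟩, rfl, rfl⟩ := hw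
    have := pow_mul_mem_orderedSpan i (hy j (Nat.le_add_left j i))
    rw [← mul_assoc, ← add_assoc] at this
    exact this
  | zero => simp
  | add u v _ _ hu hv => rw [add_mul]; exact add_mem hu hv
  | smul r u _ hu => rw [smul_mul_assoc]; exact Submodule.smul_mem _ r hu

lemma pow_mul_self_mem_orderedSpan (j : ℕ) : z ^ j * z ∈ orderedSpan k x z (j + 1) := by
  rw [← pow_succ]
  exact pow_mem_orderedSpan _

lemma pow_mul_mem_orderedSpan_of_fSeq_ne_zero (h : z * x = a • x ^ 2 + b • (x * z) + z ^ 2)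
    (hf : ∀ n, fSeq a b n ≠ 0) (j : ℕ) : z ^ j * x ∈ orderedSpan k x z (j + 1) := by
  have hx : x ∈ orderedSpan k x z 1 := by
    simpa using pow_mul_pow_mem_orderedSpan (k := k) (x := x) (z := z) 1 0
  have hz : z ∈ orderedSpan k x z 1 := by
    simpa using pow_mem_orderedSpan (k := k) (x := x) (z := z) 1
  have of_eq : ∀ n, ∀ w ∈ orderedSpan k x z (n + 1),
      fSeq a b n • (z ^ (n + 1) * x) = eSeq a b n • z ^ (n + 2) + x * w →
      z ^ (n + 1) * x ∈ orderedSpan k x z (n + 2) := by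
    intro n w hw he
    rw [← Submodule.smul_mem_iff _ (hf n), he]
    exact add_mem (Submodule.smul_mem _ _ (pow_mem_orderedSpan _)) (mul_mem_orderedSpan_left hw)
  have key : ∀ n, (∀ j ≤ n + 1, z ^ j * x ∈ orderedSpan k x z (j + 1)) ∧
      ∃ w ∈ orderedSpan k x z (n + 1),
        fSeq a b n • (z ^ (n + 1) * x) = eSeq a b n • z ^ (n + 2) + x * w := by
    intro n
    induction n with
    | zero =>
      have hw : a • x + b • z ∈ orderedSpan k x z (0 + 1) :=
        add_mem (Submodule.smul_mem _ _ hx) (Submodule.smul_mem _ _ hz)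
      refine ⟨fun j hj => ?_, _, hw, fSeq_smul_pow_mul_zero h⟩
      interval_cases j
      · simpa using hx
      · exact of_eq 0 _ hw (fSeq_smul_pow_mul_zero h)
    | succ n ih =>
      obtain ⟨hj, w, hw, he⟩ := ih
      have hw' : a • (w * x) + b • (w * z) ∈ orderedSpan k x z (n + 1 + 1) :=
        add_mem (Submodule.smul_mem _ _ (mul_mem_orderedSpan_right hj hw))
          (Submodule.smul_mem _ _
            (mul_mem_orderedSpan_right (fun j _ => pow_mul_self_mem_orderedSpan j) hw))
      refine ⟨fun j hj' => ?_, _, hw', fSeq_smul_pow_mul_step h he⟩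
      rcases Nat.le_succ_iff.1 hj' with hj' | rfl
      · exact hj j hj'
      · exact of_eq (n + 1) _ hw' (fSeq_smul_pow_mul_step h he)
  exact (key j).1 j (Nat.le_succ j)

lemma orderedSpan_le_span (n : ℕ) : orderedSpan k x z n ≤
    Submodule.span k (Set.range fun p : ℕ × ℕ => x ^ p.1 * z ^ p.2) :=
  Submodule.span_mono (Set.image_subset_range _ _)

/-- If ordered monomials form a basis then no power of `z` lies in the right ideal `x * A`. -/
lemma pow_ne_mul_of_basis
    (hli : LinearIndependent k fun p : ℕ × ℕ => x ^ p.1 * z ^ p.2)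
    (hsp : Submodule.span k (Set.range fun p : ℕ × ℕ => x ^ p.1 * z ^ p.2) = ⊤) (n : ℕ) (w : A) :
    z ^ n ≠ x * w := by
  intro h
  have hw : x * w ∈ Submodule.span k
      ((fun p : ℕ × ℕ => x ^ p.1 * z ^ p.2) '' {p | p.1 ≠ 0}) := by
    have hw : w ∈ Submodule.span k (Set.range fun p : ℕ × ℕ => x ^ p.1 * z ^ p.2) :=
      hsp ▸ Submodule.mem_top
    clear h
    induction hw using Submodule.span_induction with
    | mem w hw =>
      obtain ⟨⟨i, j⟩, rfl⟩ := hw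
      exact Submodule.subset_span ⟨(i + 1, j), Nat.succ_ne_zero i, by simp [pow_succ', mul_assoc]⟩
    | zero => simp
    | add u v _ _ hu hv => rw [mul_add]; exact add_mem hu hv
    | smul r u _ hu => rw [mul_smul_comm]; exact Submodule.smul_mem _ r hu
  rw [← h] at hw
  exact hli.notMem_span_image (s := {p | p.1 ≠ 0}) (x := (0, n)) (by simp) (by simpa using hw)

lemma eSeq_eq_zero_of_basis (h : z * x = a • x ^ 2 + b • (x * z) + z ^ 2)
    (hli : LinearIndependent k fun p : ℕ × ℕ => x ^ p.1 * z ^ p.2)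
    (hsp : Submodule.span k (Set.range fun p : ℕ × ℕ => x ^ p.1 * z ^ p.2) = ⊤) {n : ℕ}
    (hn : fSeq a b n = 0) : eSeq a b n = 0 := by
  by_contra he
  obtain ⟨w, hw⟩ := exists_fSeq_smul_pow_mul h n
  rw [hn, zero_smul] at hw
  refine pow_ne_mul_of_basis hli hsp (n + 2) (-((eSeq a b n)⁻¹ • w)) ?_
  rw [mul_neg, mul_smul_comm, eq_neg_of_add_eq_zero_right hw.symm, smul_neg,
    inv_smul_smul₀ he, neg_neg]

end Normal

section Independence

variable {k : Type*} [Field k]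

lemma linearIndependent_of_apply_eq {ι M N : Type*} [AddCommGroup M] [Module k M]
    [AddCommGroup N] [Module k N] (f : M →ₗ[k] N) {v : ι → M} {w : ι → N}
    (hw : LinearIndependent k w) (h : ∀ i, f (v i) = w i) : LinearIndependent k v := by
  obtain rfl : w = f ∘ v := funext fun i => (h i).symm
  exact hw.of_comp f

/-- Iterating an injective operator on a family that stays independent modulo its range. -/
lemma linearIndependent_pow_apply {M N : Type*} [AddCommGroup M] [Module k M] [AddCommGroup N]
    [Module k N] {X : Module.End k M} {v : ℕ → M} (π : M →ₗ[k] N)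
    (hX : Function.Injective X) (hπ : ∀ m, π (X m) = 0)
    (hv : LinearIndependent k fun j => π (v j)) :
    LinearIndependent k fun p : ℕ × ℕ => (X ^ p.1) (v p.2) := by
  have key : ∀ (n : ℕ) (c : ℕ → ℕ →₀ k),
      ∑ i ∈ Finset.range n, (X ^ i) (Finsupp.linearCombination k v (c i)) = 0 →
      ∀ i < n, c i = 0 := by
    intro n
    induction n with
    | zero => simp
    | succ n ih =>
      intro c hc
      have hsum : ∑ i ∈ Finset.range (n + 1), (X ^ i) (Finsupp.linearCombination k v (c i)) =
          X (∑ i ∈ Finset.range n, (X ^ i) (Finsupp.linearCombination k v (c (i + 1)))) +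
            Finsupp.linearCombination k v (c 0) := by
        rw [Finset.sum_range_succ', map_sum]
        simp [pow_succ', Module.End.mul_apply]
      rw [hsum] at hc
      have h0 : c 0 = 0 := by
        have h := congrArg π hc
        rw [map_add, hπ, zero_add, map_zero, Finsupp.apply_linearCombination] at h
        exact linearIndependent_iff.1 hv _ h
      rw [h0, map_zero, add_zero] at hc
      have hrest := ih (fun i => c (i + 1)) (hX (hc.trans (map_zero X).symm))
      rintro (_ | i) hi
      · exact h0
      · exact hrest i (Nat.lt_of_succ_lt_succ hi)
  rw [linearIndependent_iff]
  intro l hl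
  obtain ⟨n, hn⟩ : ∃ n, ∀ i ∈ l.curry.support, i < n :=
    ⟨l.curry.support.sup id + 1, fun i hi => Nat.lt_succ_of_le (Finset.le_sup (f := id) hi)⟩
  have hcurry : Finsupp.linearCombination k (fun p : ℕ × ℕ => (X ^ p.1) (v p.2)) l =
      ∑ i ∈ Finset.range n, (X ^ i) (Finsupp.linearCombination k v (l.curry i)) := by
    rw [Finsupp.linearCombination_apply,
      ← Finsupp.sum_curry_index l (fun i j r => r • (X ^ i) (v j)),
      Finsupp.sum_of_support_subset _ (fun i hi => Finset.mem_range.2 (hn i hi)) _ (by simp)]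
    simp [Finsupp.linearCombination_apply, Finsupp.sum]
  rw [hcurry] at hl
  ext ⟨i, j⟩
  rw [← Finsupp.curry_apply]
  by_cases hi : i < n
  · rw [key n _ hl i hi]; rfl
  · rw [Finsupp.notMem_support_iff.1 (fun h => hi (hn i h))]; rfl

open MvPolynomial in
/-- The linear substitution by which the point modules of `C(a,b,1)` are shifted. -/
def shift (a b : k) : MvPolynomial (Fin 2) k →ₐ[k] MvPolynomial (Fin 2) k :=
  aeval ![C b * X 0 + X 1, -C a * X 0 + X 1]

/-- Restriction of a polynomial in two variables to the line through `(e, f)`. -/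
def restrictLine (e f : k) : MvPolynomial (Fin 2) k →ₐ[k] Polynomial k :=
  MvPolynomial.aeval ![Polynomial.C e * Polynomial.X, Polynomial.C f * Polynomial.X]

lemma shift_injective {a b : k} (hd : a + b ≠ 0) : Function.Injective (shift a b) := by
  let τ : MvPolynomial (Fin 2) k →ₐ[k] MvPolynomial (Fin 2) k :=
    MvPolynomial.aeval ![MvPolynomial.C (a + b)⁻¹ * (MvPolynomial.X 0 - MvPolynomial.X 1),
      MvPolynomial.C (a + b)⁻¹ *
        (MvPolynomial.C a * MvPolynomial.X 0 + MvPolynomial.C b * MvPolynomial.X 1)]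
  have hC : (MvPolynomial.C (a + b)⁻¹ : MvPolynomial (Fin 2) k) *
      (MvPolynomial.C a + MvPolynomial.C b) = 1 := by
    rw [← MvPolynomial.C_add, ← MvPolynomial.C_mul, inv_mul_cancel₀ hd, MvPolynomial.C_1]
  have hτ : τ.comp (shift a b) = AlgHom.id k _ := by
    apply MvPolynomial.algHom_ext
    intro i
    fin_cases i
    · simp [τ, shift, MvPolynomial.algebraMap_eq]
      linear_combination (MvPolynomial.X 0) * hC
    · simp [τ, shift, MvPolynomial.algebraMap_eq]
      linear_combination (MvPolynomial.X 1) * hC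
  exact Function.LeftInverse.injective (g := τ) fun p => DFunLike.congr_fun hτ p

lemma restrictLine_shift (a b e f : k) (p : MvPolynomial (Fin 2) k) :
    restrictLine e f (shift a b p) = restrictLine (b * e + f) (-a * e + f) p := by
  refine DFunLike.congr_fun (?_ : (restrictLine e f).comp (shift a b) = _) p
  apply MvPolynomial.algHom_ext
  intro i
  fin_cases i
  · simp [restrictLine, shift, Polynomial.algebraMap_eq]
    ring
  · simp [restrictLine, shift, Polynomial.algebraMap_eq]
    ring

/-- The operator `p ↦ X i * shift p`. -/
def twistedMul (a b : k) (i : Fin 2) : Module.End k (MvPolynomial (Fin 2) k) :=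
  LinearMap.mulLeft k (MvPolynomial.X i) ∘ₗ (shift a b).toLinearMap

lemma twistedMul_apply (a b : k) (i : Fin 2) (p : MvPolynomial (Fin 2) k) :
    twistedMul a b i p = MvPolynomial.X i * shift a b p := rfl

lemma twistedMul_rel (a b : k) : twistedMul a b 1 * twistedMul a b 0 =
    a • twistedMul a b 0 ^ 2 + b • (twistedMul a b 0 * twistedMul a b 1) +
      (1 : k) • twistedMul a b 1 ^ 2 := by
  refine LinearMap.ext fun p => ?_
  simp only [pow_two, one_smul, LinearMap.add_apply, LinearMap.smul_apply, Module.End.mul_apply,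
    twistedMul_apply, map_mul, MvPolynomial.smul_eq_C_mul]
  simp only [shift, MvPolynomial.aeval_X, Matrix.cons_val_zero, Matrix.cons_val_one]
  ring

lemma restrictLine_twistedMul_pow {a b : k} (hf : ∀ n, fSeq a b n ≠ 0) (j n : ℕ) :
    ∃ c : kˣ, restrictLine (eSeq a b n) (fSeq a b n) ((twistedMul a b 1 ^ j) 1) =
      c • Polynomial.X ^ j := by
  induction j generalizing n with
  | zero => exact ⟨1, by simp⟩
  | succ j ih =>
    obtain ⟨c, hc⟩ := ih (n + 1)
    refine ⟨Units.mk0 _ (hf n) * c, ?_⟩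
    rw [pow_succ', Module.End.mul_apply, twistedMul_apply, map_mul, restrictLine_shift,
      ← eSeq_succ, ← fSeq_succ, hc]
    simp [restrictLine, Units.smul_def, Polynomial.smul_eq_C_mul]
    ring

lemma restrictLine_zero_one_twistedMul_pow {a b : k} (hf : ∀ n, fSeq a b n ≠ 0) (j : ℕ) :
    ∃ c : kˣ, restrictLine 0 1 ((twistedMul a b 1 ^ j) 1) = c • Polynomial.X ^ j := by
  cases j with
  | zero => exact ⟨1, by simp⟩
  | succ j =>
    obtain ⟨c, hc⟩ := restrictLine_twistedMul_pow hf j 0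
    refine ⟨c, ?_⟩
    rw [eSeq_zero, fSeq_zero] at hc
    rw [pow_succ', Module.End.mul_apply, twistedMul_apply, map_mul, restrictLine_shift, mul_zero,
      mul_zero, zero_add, hc]
    simp [restrictLine, Units.smul_def, Polynomial.smul_eq_C_mul]
    ring

lemma linearIndependent_of_add_ne_zero {a b : k} (hf : ∀ n, fSeq a b n ≠ 0) (hd : a + b ≠ 0) :
    LinearIndependent k fun p : ℕ × ℕ => Cx k a b 1 ^ p.1 * Cz k a b 1 ^ p.2 := by
  obtain ⟨φ, hx, hz⟩ := Calg.exists_algHom (twistedMul_rel a b)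
  have hX : Function.Injective (twistedMul a b 0) := fun p q h =>
    shift_injective hd (mul_left_cancel₀ (MvPolynomial.X_ne_zero 0) h)
  choose c hc using restrictLine_zero_one_twistedMul_pow hf
  have hv : LinearIndependent k fun j =>
      (restrictLine (0 : k) 1).toLinearMap ((twistedMul a b 1 ^ j) 1) := by
    have h := (Polynomial.basisMonomials k).linearIndependent.units_smul c
    convert h using 2 with j
    simp [hc, Polynomial.X_pow_eq_monomial]
  have h := linearIndependent_pow_apply (restrictLine (0 : k) 1).toLinearMap hX
    (fun p => by simp [twistedMul_apply, restrictLine]) hv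
  refine linearIndependent_of_apply_eq (LinearMap.applyₗ 1 ∘ₗ φ.toLinearMap) h fun p => ?_
  simp [hx, hz]

/-- Right multiplication by `x` on ordered monomials in `C(a,-a,1)`. -/
def rightX (a : k) : Module.End k (ℕ × ℕ →₀ k) :=
  Finsupp.linearCombination k fun p => Finsupp.single (p.1, p.2 + 1) 1 +
    a ^ p.2 • (Finsupp.single (p.1 + p.2 + 1, 0) 1 - Finsupp.single (p.1 + p.2, 1) 1)

/-- Right multiplication by `z` on ordered monomials. -/
def rightZ (k : Type*) [Field k] : Module.End k (ℕ × ℕ →₀ k) :=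
  Finsupp.linearCombination k fun p => Finsupp.single (p.1, p.2 + 1) 1

lemma rightX_single (a : k) (i j : ℕ) : rightX a (Finsupp.single (i, j) 1) =
    Finsupp.single (i, j + 1) 1 +
      a ^ j • (Finsupp.single (i + j + 1, 0) 1 - Finsupp.single (i + j, 1) 1) := by
  simp [rightX]

lemma rightZ_single (i j : ℕ) :
    rightZ k (Finsupp.single (i, j) 1) = Finsupp.single (i, j + 1) 1 := by
  simp [rightZ]

lemma right_rel (a : k) : rightX a * rightZ k =
    a • rightX a ^ 2 + -a • (rightZ k * rightX a) + (1 : k) • rightZ k ^ 2 := by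
  ext1 ⟨i, j⟩
  ext1
  simp only [LinearMap.comp_apply, Finsupp.lsingle_apply, LinearMap.add_apply,
    LinearMap.smul_apply, Module.End.mul_apply, rightX_single, rightZ_single, map_add, map_sub,
    map_smul, add_zero, zero_add, pow_zero, one_smul, pow_succ]
  rw [show i + (j + 1) + 1 = i + j + 1 + 1 by ring, show i + (j + 1) = i + j + 1 by ring]
  module

lemma linearIndependent_neg (a : k) :
    LinearIndependent k fun p : ℕ × ℕ => Cx k a (-a) 1 ^ p.1 * Cz k a (-a) 1 ^ p.2 := by
  obtain ⟨φ, hx, hz⟩ := Calg.exists_algHom (k := k) (B := (Module.End k (ℕ × ℕ →₀ k))ᵐᵒᵖ)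
    (X := .op (rightX a)) (Z := .op (rightZ k)) (a := a) (b := -a) (c := 1)
    (MulOpposite.unop_injective (by simpa using right_rel a))
  have hX : ∀ i, (rightX a ^ i) (Finsupp.single (0, 0) 1) = Finsupp.single (i, 0) 1 := by
    intro i
    induction i with
    | zero => simp
    | succ i ih => rw [pow_succ', Module.End.mul_apply, ih, rightX_single]; simp
  have hZ : ∀ i j, (rightZ k ^ j) (Finsupp.single (i, 0) 1) = Finsupp.single (i, j) 1 := by
    intro i j
    induction j with
    | zero => simp
    | succ j ih => rw [pow_succ', Module.End.mul_apply, ih, rightZ_single]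
  refine linearIndependent_of_apply_eq (LinearMap.applyₗ (Finsupp.single (0, 0) 1) ∘ₗ
    (MulOpposite.opLinearEquiv k).symm.toLinearMap ∘ₗ φ.toLinearMap)
    (Finsupp.basisSingleOne (R := k) (ι := ℕ × ℕ)).linearIndependent fun p => ?_
  simp [hx, hz, hX, hZ]

end Independence

section Degenerate

variable {k : Type*} [Field k]

lemma span_ne_top_one_neg_one : Submodule.span k (Set.range fun p : ℕ × ℕ =>
    Cx k 1 (-1) 1 ^ p.1 * Cz k 1 (-1) 1 ^ p.2) ≠ ⊤ := by
  let X : Matrix (Fin 4) (Fin 4) k := !![0, 0, 0, 0; 0, 0, 1, 0; 0, 0, 0, 1; 0, 0, 0, 0]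
  let Z : Matrix (Fin 4) (Fin 4) k := !![0, 1, 0, 0; 0, 0, 1, 0; 0, 0, 0, 0; 0, 0, 0, 0]
  have hrel : Z * X = (1 : k) • X ^ 2 + (-1 : k) • (X * Z) + (1 : k) • Z ^ 2 := by
    ext i j
    fin_cases i <;> fin_cases j <;> simp [X, Z, pow_two, Matrix.mul_apply, Fin.sum_univ_four]
  obtain ⟨φ, hx, hz⟩ := Calg.exists_algHom hrel
  have hXrow : ∀ B : Matrix (Fin 4) (Fin 4) k, (X * B) 0 3 = 0 := by
    intro B
    simp [X, Matrix.mul_apply, Fin.sum_univ_four]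
  have hZcol : ∀ B : Matrix (Fin 4) (Fin 4) k, (B * Z) 0 3 = 0 := by
    intro B
    simp [Z, Matrix.mul_apply, Fin.sum_univ_four]
  let L : Calg k 1 (-1) 1 →ₗ[k] k := Matrix.entryLinearMap k k 0 3 ∘ₗ φ.toLinearMap
  intro htop
  have hL : L = 0 := by
    refine LinearMap.ext_on_range htop ?_
    rintro ⟨_ | i, j⟩
    · cases j with
      | zero => simp [L]
      | succ j => simp [L, hz, pow_succ, hZcol]
    · simp [L, hx, hz, pow_succ', mul_assoc, hXrow]
  have h := DFunLike.congr_fun hL (Cz k 1 (-1) 1 * (Cz k 1 (-1) 1 * Cx k 1 (-1) 1))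
  simp [L, hx, hz, X, Z] at h

end Degenerate

/-- The family `(i,j) ↦ x^i z^j` is a `k`-basis of `C(a,b,1)` if and only if
`f_n(a,b) ≠ 0` for all `n ≥ 0`. -/
theorem stmt2 {k : Type*} [Field k] [IsAlgClosed k] (a b : k) :
    (LinearIndependent k (fun p : ℕ × ℕ => (Cx k a b 1) ^ p.1 * (Cz k a b 1) ^ p.2) ∧
      Submodule.span k
        (Set.range fun p : ℕ × ℕ => (Cx k a b 1) ^ p.1 * (Cz k a b 1) ^ p.2) = ⊤) ↔
    (∀ n : ℕ, fSeq a b n ≠ 0) := by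
  have hrel := Calg.rel a b (1 : k)
  rw [one_smul] at hrel
  constructor
  · rintro ⟨hli, hsp⟩ n hn
    obtain ⟨rfl, rfl⟩ :=
      eq_one_of_eSeq_fSeq_eq_zero (eSeq_eq_zero_of_basis hrel hli hsp hn) hn
    exact span_ne_top_one_neg_one hsp
  · intro hf
    refine ⟨?_, ?_⟩
    · by_cases hd : a + b = 0
      · obtain rfl : b = -a := by linear_combination hd
        exact linearIndependent_neg a
      · exact linearIndependent_of_add_ne_zero hf hd
    · have stable : ∀ y : Calg k a b 1,
          (∀ j, Cz k a b 1 ^ j * y ∈ orderedSpan k (Cx k a b 1) (Cz k a b 1) (j + 1)) →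
          ∀ w ∈ Submodule.span k
            (Set.range fun p : ℕ × ℕ => (Cx k a b 1) ^ p.1 * (Cz k a b 1) ^ p.2),
          w * y ∈ Submodule.span k
            (Set.range fun p : ℕ × ℕ => (Cx k a b 1) ^ p.1 * (Cz k a b 1) ^ p.2) := by
        intro y hy w hw
        induction hw using Submodule.span_induction with
        | mem w hw =>
          obtain ⟨⟨i, j⟩, rfl⟩ := hw
          exact orderedSpan_le_span _ (mul_mem_orderedSpan_right (fun j _ => hy j)
            (pow_mul_pow_mem_orderedSpan i j))
        | zero => simp
        | add u v _ _ hu hv => rw [add_mul]; exact add_mem hu hv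
        | smul r u _ hu => rw [smul_mul_assoc]; exact Submodule.smul_mem _ r hu
      exact Calg.eq_top_of_mul_mem _ (Submodule.subset_span ⟨(0, 0), by simp⟩)
        (stable _ (pow_mul_mem_orderedSpan_of_fSeq_ne_zero hrel hf))
        (stable _ pow_mul_self_mem_orderedSpan)
end
end

section
/- Let k be an algebraically closed field and a, b, a', b' ∈ k. Suppose that in both C(a,b,1) and C(a',b',1) the family (i,j) ↦ x^i·z^j is a k-vector-space basis. Suppose α, β ∈ k are nonzero and that in C(a',b',1) the element (βz)(αx) - a·(αx)² - b·(αx)(βz) - (βz)² equals 0 (i.e., the assignment x ↦ αx, z ↦ βz descends to an algebra homomorphism C(a,b,1) → C(a',b',1)). Then a = a' and b = b'. -/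
noncomputable section

open FreeAlgebra

/-- The defining relation `zx = a·x² + b·xz + c·z²` holds in `C(a,b,c)`. -/
theorem Cz_mul_Cx {k : Type*} [Field k] (a b c : k) :
    Cz k a b c * Cx k a b c =
      a • Cx k a b c ^ 2 + b • (Cx k a b c * Cz k a b c) + c • Cz k a b c ^ 2 := by
  have h := RingQuot.mkAlgHom_rel k (s := Crel k a b c) ⟨rfl, rfl⟩
  simpa only [map_mul, map_add, map_smul, map_pow, ← Cx.eq_def, ← Cz.eq_def] using h

/-- If the monomials `x^i z^j` are linearly independent, then so are `x²`, `xz` and `z²`. -/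
theorem eq_zero_of_quadratic_eq_zero {k A : Type*} [Field k] [Ring A] [Algebra k A] {x z : A}
    (h : LinearIndependent k (fun p : ℕ × ℕ => x ^ p.1 * z ^ p.2)) {r s t : k}
    (hrst : r • x ^ 2 + s • (x * z) + t • z ^ 2 = 0) : r = 0 ∧ s = 0 ∧ t = 0 := by
  have hinj : Function.Injective (![(2, 0), (1, 1), (0, 2)] : Fin 3 → ℕ × ℕ) := by decide
  have h0 := Fintype.linearIndependent_iff.1 (h.comp _ hinj) ![r, s, t]
    (by simpa [Fin.sum_univ_three] using hrst)
  exact ⟨h0 0, h0 1, h0 2⟩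

/-- Rigidity of `C(a,b,1)` as a twisted tensor product: if `(i,j) ↦ x^i z^j` is a basis of
both `C(a,b,1)` and `C(a',b',1)`, and nonzero scalars `α, β` are such that `x ↦ αx`, `z ↦ βz`
descends to an algebra homomorphism `C(a,b,1) → C(a',b',1)`, then `a = a'` and `b = b'`. -/
theorem stmt4 {k : Type*} [Field k] [IsAlgClosed k] (a b a' b' : k)
    (hbasis : LinearIndependent k
        (fun p : ℕ × ℕ => (Cx k a b 1) ^ p.1 * (Cz k a b 1) ^ p.2) ∧
      Submodule.span k
        (Set.range fun p : ℕ × ℕ => (Cx k a b 1) ^ p.1 * (Cz k a b 1) ^ p.2) = ⊤)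
    (hbasis' : LinearIndependent k
        (fun p : ℕ × ℕ => (Cx k a' b' 1) ^ p.1 * (Cz k a' b' 1) ^ p.2) ∧
      Submodule.span k
        (Set.range fun p : ℕ × ℕ => (Cx k a' b' 1) ^ p.1 * (Cz k a' b' 1) ^ p.2) = ⊤)
    (α β : k) (hα : α ≠ 0) (hβ : β ≠ 0)
    (hrel : (β • Cz k a' b' 1) * (α • Cx k a' b' 1) - a • (α • Cx k a' b' 1) ^ 2 -
        b • ((α • Cx k a' b' 1) * (β • Cz k a' b' 1)) - (β • Cz k a' b' 1) ^ 2 = 0) :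
    a = a' ∧ b = b' := by
  have hzero : (α * β * a' - a * α ^ 2) • Cx k a' b' 1 ^ 2 +
      (α * β * b' - b * (α * β)) • (Cx k a' b' 1 * Cz k a' b' 1) +
      (α * β - β ^ 2) • Cz k a' b' 1 ^ 2 = 0 := by
    rw [← hrel]
    simp only [smul_mul_smul_comm, smul_pow, Cz_mul_Cx]
    module
  obtain ⟨hr, hs, ht⟩ := eq_zero_of_quadratic_eq_zero hbasis'.1 hzero
  have hαβ : α = β := mul_right_cancel₀ hβ (by linear_combination ht)
  subst hαβ
  have hα2 : α ^ 2 ≠ 0 := pow_ne_zero 2 hα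
  exact ⟨mul_right_cancel₀ hα2 (by linear_combination -hr),
    mul_right_cancel₀ hα2 (by linear_combination -hs)⟩
end
end

section
/- Let k be an algebraically closed field and b ∈ k with b ≠ 1. Then there is a k-algebra isomorphism between C(1,b,0) and the skew polynomial algebra k_b[x,z] = k⟨x,z⟩/⟨zx - b·xz⟩. -/
noncomputable section

open FreeAlgebra

/-- The relation defining the skew polynomial algebra `k_q[x,z]`: `zx = q·xz`. -/
def Qrel (k : Type*) [Field k] (q : k) :
    FreeAlgebra k (Fin 2) → FreeAlgebra k (Fin 2) → Prop := fun m n =>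
  m = Zf k * Xf k ∧ n = q • (Xf k * Zf k)

/-- The skew polynomial algebra `k_q[x,z] = k⟨x,z⟩/⟨zx - q·xz⟩`. -/
abbrev Qalg (k : Type*) [Field k] (q : k) := RingQuot (Qrel k q)

/-- The relation `zx = q·xz` holds in the skew polynomial algebra. -/
theorem Qalg_relation {k : Type*} [Field k] (q : k) :
    RingQuot.mkAlgHom k (Qrel k q) (Zf k) * RingQuot.mkAlgHom k (Qrel k q) (Xf k) =
      q • (RingQuot.mkAlgHom k (Qrel k q) (Xf k) * RingQuot.mkAlgHom k (Qrel k q) (Zf k)) := by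
  simpa only [map_mul, map_smul] using
    RingQuot.mkAlgHom_rel k (s := Qrel k q) ⟨rfl, rfl⟩

/-- The relation `zx = a·x² + b·xz + c·z²` holds in `C(a,b,c)`. -/
theorem Calg_relation {k : Type*} [Field k] (a b c : k) :
    RingQuot.mkAlgHom k (Crel k a b c) (Zf k) * RingQuot.mkAlgHom k (Crel k a b c) (Xf k) =
      a • RingQuot.mkAlgHom k (Crel k a b c) (Xf k) ^ 2 +
      b • (RingQuot.mkAlgHom k (Crel k a b c) (Xf k) *
        RingQuot.mkAlgHom k (Crel k a b c) (Zf k)) +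
      c • RingQuot.mkAlgHom k (Crel k a b c) (Zf k) ^ 2 := by
  simpa only [map_mul, map_smul, map_add, map_pow] using
    RingQuot.mkAlgHom_rel k (s := Crel k a b c) ⟨rfl, rfl⟩

/-- The algebra map out of `k_q[x,z]` given by two elements with `zx = q·xz`. -/
def Qalg.lift {k A : Type*} [Field k] [Ring A] [Algebra k A] {q : k} (x z : A)
    (h : z * x = q • (x * z)) : Qalg k q →ₐ[k] A :=
  RingQuot.liftAlgHom k ⟨FreeAlgebra.lift k ![x, z], by
    rintro _ _ ⟨rfl, rfl⟩
    simpa [Xf, Zf] using h⟩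

/-- The algebra map out of `C(a,b,c)` given by two elements with `zx = a·x² + b·xz + c·z²`. -/
def Calg.lift {k A : Type*} [Field k] [Ring A] [Algebra k A] {a b c : k} (x z : A)
    (h : z * x = a • x ^ 2 + b • (x * z) + c • z ^ 2) : Calg k a b c →ₐ[k] A :=
  RingQuot.liftAlgHom k ⟨FreeAlgebra.lift k ![x, z], by
    rintro _ _ ⟨rfl, rfl⟩
    simpa [Xf, Zf] using h⟩

/-- Algebra maps out of a quotient of `k⟨x,z⟩` are determined by the images of `x` and `z`. -/
theorem ringQuot_hom_ext {k A : Type*} [Field k] [Ring A] [Algebra k A]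
    {r : FreeAlgebra k (Fin 2) → FreeAlgebra k (Fin 2) → Prop} {f g : RingQuot r →ₐ[k] A}
    (hx : f (RingQuot.mkAlgHom k r (Xf k)) = g (RingQuot.mkAlgHom k r (Xf k)))
    (hz : f (RingQuot.mkAlgHom k r (Zf k)) = g (RingQuot.mkAlgHom k r (Zf k))) : f = g := by
  refine RingQuot.ringQuot_ext' k f g (FreeAlgebra.hom_ext (funext fun i => ?_))
  fin_cases i
  · exact hx
  · exact hz

section lift

variable {k A : Type*} [Field k] [Ring A] [Algebra k A]

@[simp] theorem Qalg.lift_x {q : k} (x z : A) (h : z * x = q • (x * z)) :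
    Qalg.lift x z h (RingQuot.mkAlgHom k (Qrel k q) (Xf k)) = x := by
  simp [Qalg.lift, Xf]

@[simp] theorem Qalg.lift_z {q : k} (x z : A) (h : z * x = q • (x * z)) :
    Qalg.lift x z h (RingQuot.mkAlgHom k (Qrel k q) (Zf k)) = z := by
  simp [Qalg.lift, Zf]

@[simp] theorem Calg.lift_x {a b c : k} (x z : A)
    (h : z * x = a • x ^ 2 + b • (x * z) + c • z ^ 2) :
    Calg.lift x z h (RingQuot.mkAlgHom k (Crel k a b c) (Xf k)) = x := by
  simp [Calg.lift, Xf]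

@[simp] theorem Calg.lift_z {a b c : k} (x z : A)
    (h : z * x = a • x ^ 2 + b • (x * z) + c • z ^ 2) :
    Calg.lift x z h (RingQuot.mkAlgHom k (Crel k a b c) (Zf k)) = z := by
  simp [Calg.lift, Zf]

end lift

/-- If `b ≠ 1`, then `C(1,b,0)` is isomorphic as a `k`-algebra to `k_b[x,z]`. -/
theorem stmt5 {k : Type*} [Field k] [IsAlgClosed k] (b : k) (hb : b ≠ 1) :
    Nonempty (Calg k 1 b 0 ≃ₐ[k] Qalg k b) := by
  obtain ⟨t, ht⟩ : ∃ t : k, b * t = 1 + t :=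
    ⟨(b - 1)⁻¹, by have := sub_ne_zero.2 hb; field_simp; ring⟩
  have hQ := Qalg_relation b
  have hC := Calg_relation 1 b 0
  set x := RingQuot.mkAlgHom k (Qrel k b) (Xf k) with hx
  set z := RingQuot.mkAlgHom k (Qrel k b) (Zf k) with hz
  set x' := RingQuot.mkAlgHom k (Crel k 1 b 0) (Xf k) with hx'
  set z' := RingQuot.mkAlgHom k (Crel k 1 b 0) (Zf k) with hz'
  have h₁ : (z - t • x) * x = (1 : k) • x ^ 2 + b • (x * (z - t • x)) +
      (0 : k) • (z - t • x) ^ 2 := by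
    rw [sub_mul, hQ, mul_sub, smul_sub, smul_mul_assoc, mul_smul_comm, smul_smul, ht, ← pow_two]
    module
  have h₂ : (z' + t • x') * x' = b • (x' * (z' + t • x')) := by
    rw [add_mul, hC, mul_add, smul_add, smul_mul_assoc, mul_smul_comm, smul_smul, ht, ← pow_two]
    module
  refine ⟨AlgEquiv.ofAlgHom (Calg.lift x (z - t • x) h₁) (Qalg.lift x' (z' + t • x') h₂)
    (ringQuot_hom_ext ?_ ?_) (ringQuot_hom_ext ?_ ?_)⟩ <;>
  simp [hx, hz, hx', hz']
end
end

section
/- Let k be an algebraically closed field and a, b ∈ k be such that f_n ≠ 0 for all n ≥ 0 (f_n computed from the pair (a,b)) and 4a - (b-1)² = 0. Then there is a k-algebra isomorphism between C(a,b,1) and the Jordan plane J = k⟨x,z⟩/⟨zx - xz - z²⟩. -/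
noncomputable section

open FreeAlgebra

/-- The relation defining the Jordan plane: `zx = xz + z²`. -/
def Jrel (k : Type*) [Field k] :
    FreeAlgebra k (Fin 2) → FreeAlgebra k (Fin 2) → Prop := fun m n =>
  m = Zf k * Xf k ∧ n = Xf k * Zf k + (Zf k) ^ 2

/-- The Jordan plane `J = k⟨x,z⟩/⟨zx - xz - z²⟩`. -/
abbrev Jalg (k : Type*) [Field k] := RingQuot (Jrel k)

/-- A choice of square root of `a` that simultaneously solves `2s = 1 - b`; this treats every
characteristic uniformly. -/
lemma exists_sq_eq_and_two_mul_eq {k : Type*} [Field k] [IsAlgClosed k] {a b : k}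
    (hq : 4 * a - (b - 1) ^ 2 = 0) : ∃ s : k, s ^ 2 = a ∧ 2 * s = 1 - b := by
  obtain ⟨s, hs⟩ := IsAlgClosed.exists_pow_nat_eq a (n := 2) two_pos
  have h : (2 * s) ^ 2 = (1 - b) ^ 2 := by linear_combination 4 * hs + hq
  rcases sq_eq_sq_iff_eq_or_eq_neg.mp h with h | h
  · exact ⟨s, hs, h⟩
  · exact ⟨-s, by rw [neg_sq, hs], by linear_combination -h⟩

/-- Images of the generators of the Jordan plane satisfy the relation of `C(s², 1 - 2s, 1)`. -/
lemma calg_relation_of_jordan {k A : Type*} [Field k] [Ring A] [Algebra k A] {s v : k}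
    (hv : v * (1 - s) = 1) {x z : A} (h : z * x = x * z + z ^ 2) :
    (z + (s * v) • x) * (v • x) = (s ^ 2) • (v • x) ^ 2 +
      (1 - 2 * s) • ((v • x) * (z + (s * v) • x)) + (1 : k) • (z + (s * v) • x) ^ 2 := by
  simp only [pow_two, mul_add, add_mul, smul_mul_assoc, mul_smul_comm] at h ⊢
  rw [h]
  match_scalars
  · ring
  · linear_combination hv
  · ring

/-- Images of the generators of `C(s², 1 - 2s, 1)` satisfy the relation of the Jordan plane. -/
lemma jordan_relation_of_calg {k A : Type*} [Field k] [Ring A] [Algebra k A] {s : k} {x z : A}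
    (h : z * x = (s ^ 2) • x ^ 2 + (1 - 2 * s) • (x * z) + (1 : k) • z ^ 2) :
    (z - s • x) * ((1 - s) • x) = ((1 - s) • x) * (z - s • x) + (z - s • x) ^ 2 := by
  simp only [pow_two, mul_sub, sub_mul, smul_mul_assoc, mul_smul_comm] at h ⊢
  rw [h]
  module

/-- If `f_n(a,b) ≠ 0` for all `n ≥ 0` and `4a - (b-1)² = 0`, then `C(a,b,1)` is isomorphic
as a `k`-algebra to the Jordan plane. -/
theorem stmt7 {k : Type*} [Field k] [IsAlgClosed k] (a b : k)
    (hf : ∀ n : ℕ, fSeq a b n ≠ 0) (hq : 4 * a - (b - 1) ^ 2 = 0) :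
    Nonempty (Calg k a b 1 ≃ₐ[k] Jalg k) := by
  obtain ⟨s, rfl, hb⟩ := exists_sq_eq_and_two_mul_eq hq
  obtain rfl : b = 1 - 2 * s := by linear_combination hb
  have hs : 1 - s ≠ 0 := fun h => hf 1 <| by
    simp only [fSeq, efPair]
    linear_combination (1 + s) * h
  obtain ⟨v, hv⟩ : ∃ v, v * (1 - s) = 1 := ⟨_, inv_mul_cancel₀ hs⟩
  let πC := RingQuot.mkAlgHom k (Crel k (s ^ 2) (1 - 2 * s) 1)
  let πJ := RingQuot.mkAlgHom k (Jrel k)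
  have hC : πC (Zf k) * πC (Xf k) = (s ^ 2) • πC (Xf k) ^ 2 +
      (1 - 2 * s) • (πC (Xf k) * πC (Zf k)) + (1 : k) • πC (Zf k) ^ 2 := by
    simpa only [map_mul, map_add, map_smul, map_pow] using
      RingQuot.mkAlgHom_rel k (s := Crel k (s ^ 2) (1 - 2 * s) 1) ⟨rfl, rfl⟩
  have hJ : πJ (Zf k) * πJ (Xf k) = πJ (Xf k) * πJ (Zf k) + πJ (Zf k) ^ 2 := by
    simpa only [map_mul, map_add, map_pow] using
      RingQuot.mkAlgHom_rel k (s := Jrel k) ⟨rfl, rfl⟩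
  let toJ : Calg k (s ^ 2) (1 - 2 * s) 1 →ₐ[k] Jalg k := RingQuot.liftAlgHom k
    ⟨FreeAlgebra.lift k ![v • πJ (Xf k), πJ (Zf k) + (s * v) • πJ (Xf k)], by
      rintro _ _ ⟨rfl, rfl⟩
      simpa [Xf, Zf] using calg_relation_of_jordan hv hJ⟩
  let toC : Jalg k →ₐ[k] Calg k (s ^ 2) (1 - 2 * s) 1 := RingQuot.liftAlgHom k
    ⟨FreeAlgebra.lift k ![(1 - s) • πC (Xf k), πC (Zf k) - s • πC (Xf k)], by
      rintro _ _ ⟨rfl, rfl⟩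
      simpa [Xf, Zf] using jordan_relation_of_calg hC⟩
  have toJ_X : toJ (πC (Xf k)) = v • πJ (Xf k) := by simp [toJ, πC, Xf]
  have toJ_Z : toJ (πC (Zf k)) = πJ (Zf k) + (s * v) • πJ (Xf k) := by simp [toJ, πC, Zf]
  have toC_X : toC (πJ (Xf k)) = (1 - s) • πC (Xf k) := by simp [toC, πJ, Xf]
  have toC_Z : toC (πJ (Zf k)) = πC (Zf k) - s • πC (Xf k) := by simp [toC, πJ, Zf]
  refine ⟨AlgEquiv.ofAlgHom toJ toC ?_ ?_⟩
  · apply RingQuot.ringQuot_ext'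
    apply FreeAlgebra.hom_ext
    funext i
    fin_cases i
    · change toJ (toC (πJ (Xf k))) = πJ (Xf k)
      rw [toC_X, map_smul, toJ_X]
      match_scalars
      linear_combination hv
    · change toJ (toC (πJ (Zf k))) = πJ (Zf k)
      rw [toC_Z, map_sub, map_smul, toJ_X, toJ_Z]
      module
  · apply RingQuot.ringQuot_ext'
    apply FreeAlgebra.hom_ext
    funext i
    fin_cases i
    · change toC (toJ (πC (Xf k))) = πC (Xf k)
      rw [toJ_X, map_smul, toC_X]
      match_scalars
      linear_combination hv
    · change toC (toJ (πC (Zf k))) = πC (Zf k)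
      rw [toJ_Z, map_add, map_smul, toC_X, toC_Z]
      match_scalars
      · ring
      · linear_combination s * hv
end
end

section
/- Let k be an algebraically closed field and a, b ∈ k be such that f_n ≠ 0 for all n ≥ 0 (f_n computed from the pair (a,b)), b ≠ -1, and 4a - (b-1)² ≠ 0. If q ∈ k satisfies (a+b)·q² + (2a - b² - 1)·q + a + b = 0, then q ∉ {1,-1} and there is a k-algebra isomorphism between C(a,b,1) and k_q[x,z] = k⟨x,z⟩/⟨zx - q·xz⟩. -/
noncomputable section

open FreeAlgebra

/-- The linear change of variables `X = z - r·x`, `Z = z - s·x` turns the defining relation of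
`C(rs, 1 - r - s, 1)` into a multiple of that of `k_q`, provided `r - q·s = 1 - q`. -/
lemma relation_change {k A : Type*} [Field k] [Ring A] [Algebra k A] {q r s : k}
    (h : r = 1 - q + q * s) (x z : A) :
    (z - s • x) * (z - r • x) - q • ((z - r • x) * (z - s • x)) =
      (q - 1) • (z * x - ((r * s) • x ^ 2 + (1 - r - s) • (x * z) + (1 : k) • z ^ 2)) := by
  subst h
  simp only [sub_mul, mul_sub, smul_mul_assoc, mul_smul_comm, pow_two]
  module

/-- Two elements satisfying the defining relation of `C(a,b,c)` induce a map out of it. -/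
def CalgLift {k A : Type*} [Field k] [Ring A] [Algebra k A] (a b c : k) (x z : A)
    (h : z * x = a • x ^ 2 + b • (x * z) + c • z ^ 2) : Calg k a b c →ₐ[k] A :=
  RingQuot.liftAlgHom k ⟨FreeAlgebra.lift k ![x, z], by
    rintro _ _ ⟨rfl, rfl⟩
    simpa [Xf, Zf] using h⟩

/-- Two elements satisfying the defining relation of `k_q[x,z]` induce a map out of it. -/
def QalgLift {k A : Type*} [Field k] [Ring A] [Algebra k A] (q : k) (x z : A)
    (h : z * x = q • (x * z)) : Qalg k q →ₐ[k] A :=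
  RingQuot.liftAlgHom k ⟨FreeAlgebra.lift k ![x, z], by
    rintro _ _ ⟨rfl, rfl⟩
    simpa [Xf, Zf] using h⟩

lemma nonempty_algEquiv_of_roots {k : Type*} [Field k] {q r s : k} (h : r = 1 - q + q * s)
    (hq : q ≠ 1) (hrs : r ≠ s) :
    Nonempty (Calg k (r * s) (1 - r - s) 1 ≃ₐ[k] Qalg k q) := by
  have hsr : s - r ≠ 0 := sub_ne_zero.2 hrs.symm
  let xC : Calg k (r * s) (1 - r - s) 1 := RingQuot.mkAlgHom k _ (Xf k)
  let zC : Calg k (r * s) (1 - r - s) 1 := RingQuot.mkAlgHom k _ (Zf k)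
  let xQ : Qalg k q := RingQuot.mkAlgHom k _ (Xf k)
  let zQ : Qalg k q := RingQuot.mkAlgHom k _ (Zf k)
  have hC : zC * xC = (r * s) • xC ^ 2 + (1 - r - s) • (xC * zC) + (1 : k) • zC ^ 2 := by
    simpa only [map_mul, map_add, map_smul, map_pow] using
      RingQuot.mkAlgHom_rel k (s := Crel k (r * s) (1 - r - s) 1) ⟨rfl, rfl⟩
  have hQ : zQ * xQ = q • (xQ * zQ) := by
    simpa only [map_mul, map_smul] using
      RingQuot.mkAlgHom_rel k (s := Qrel k q) ⟨rfl, rfl⟩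
  let x' : Qalg k q := (s - r)⁻¹ • (xQ - zQ)
  let z' : Qalg k q := xQ + r • x'
  have hx' : z' - r • x' = xQ := add_sub_cancel_right _ _
  have hz' : z' - s • x' = zQ := by
    have : s • x' - r • x' = xQ - zQ := (sub_smul s r x').symm.trans (smul_inv_smul₀ hsr _)
    rw [show z' - s • x' = xQ - (s • x' - r • x') by simp only [z']; abel, this]
    abel
  have hCQ : z' * x' = (r * s) • x' ^ 2 + (1 - r - s) • (x' * z') + (1 : k) • z' ^ 2 := by
    have key := relation_change h x' z'
    rw [hx', hz', hQ, sub_self, eq_comm, smul_eq_zero_iff_right (sub_ne_zero.2 hq)] at key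
    exact sub_eq_zero.1 key
  have hQC : (zC - s • xC) * (zC - r • xC) = q • ((zC - r • xC) * (zC - s • xC)) := by
    have key := relation_change h xC zC
    rw [hC, sub_self, smul_zero] at key
    exact sub_eq_zero.1 key
  let F := CalgLift _ _ _ x' z' hCQ
  let G := QalgLift q _ _ hQC
  have hFx : F xC = x' := by simp [F, xC, CalgLift, Xf]
  have hFz : F zC = z' := by simp [F, zC, CalgLift, Zf]
  have hGx : G xQ = zC - r • xC := by simp [G, xQ, QalgLift, Xf]
  have hGz : G zQ = zC - s • xC := by simp [G, zQ, QalgLift, Zf]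
  have hGx' : G x' = xC := by
    simp only [x', map_smul, map_sub, hGx, hGz]
    rw [inv_smul_eq_iff₀ hsr]
    module
  have hGz' : G z' = zC := by
    simp only [z', map_add, map_smul, hGx, hGx']
    abel
  refine ⟨AlgEquiv.ofAlgHom F G ?_ ?_⟩
  · ext i
    fin_cases i
    · change F (G xQ) = xQ
      rw [hGx, map_sub, map_smul, hFx, hFz, hx']
    · change F (G zQ) = zQ
      rw [hGz, map_sub, map_smul, hFx, hFz, hz']
  · ext i
    fin_cases i
    · change G (F xC) = xC
      rw [hFx, hGx']
    · change G (F zC) = zC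
      rw [hFz, hGz']

lemma exists_add_eq_mul_eq {k : Type*} [Field k] [IsAlgClosed k] (a t : k) :
    ∃ r s : k, r + s = t ∧ r * s = a := by
  obtain ⟨r, hr⟩ := IsAlgClosed.exists_root
    (Polynomial.C 1 * Polynomial.X ^ 2 + Polynomial.C (-t) * Polynomial.X + Polynomial.C a)
    (by rw [Polynomial.degree_quadratic one_ne_zero]; decide)
  refine ⟨r, t - r, by ring, ?_⟩
  simp only [Polynomial.IsRoot, Polynomial.eval_add, Polynomial.eval_mul, Polynomial.eval_pow,
    Polynomial.eval_C, Polynomial.eval_X] at hr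
  linear_combination -hr

/-- If `f_n(a,b) ≠ 0` for all `n`, `b ≠ -1`, `4a - (b-1)² ≠ 0`, and `q` satisfies
`(a+b)q² + (2a - b² - 1)q + a + b = 0`, then `q ∉ {1,-1}` and `C(a,b,1)` is isomorphic
as a `k`-algebra to `k_q[x,z]`. -/
theorem stmt8 {k : Type*} [Field k] [IsAlgClosed k] (a b : k)
    (hf : ∀ n : ℕ, fSeq a b n ≠ 0) (hb : b ≠ -1) (hq : 4 * a - (b - 1) ^ 2 ≠ 0)
    (q : k) (hqeq : (a + b) * q ^ 2 + (2 * a - b ^ 2 - 1) * q + a + b = 0) :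
    q ≠ 1 ∧ q ≠ -1 ∧ Nonempty (Calg k a b 1 ≃ₐ[k] Qalg k q) := by
  have hq1 : q ≠ 1 := by
    rintro rfl
    exact hq (by linear_combination hqeq)
  refine ⟨hq1, ?_, ?_⟩
  · rintro rfl
    have h : (b + 1) ^ 2 = 0 := by linear_combination hqeq
    exact hb (eq_neg_of_add_eq_zero_left (pow_eq_zero_iff two_ne_zero |>.1 h))
  · obtain ⟨r, s, hsum, rfl⟩ := exists_add_eq_mul_eq a (1 - b)
    obtain rfl : b = 1 - r - s := by linear_combination hsum
    have hrs : r ≠ s := by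
      rintro rfl
      exact hq (by ring)
    have hfac : (r - (1 - q + q * s)) * (s - (1 - q + q * r)) = 0 := by
      linear_combination hqeq
    rcases mul_eq_zero.1 hfac with h | h
    · exact nonempty_algEquiv_of_roots (sub_eq_zero.1 h) hq1 hrs
    · rw [mul_comm r s, sub_right_comm]
      exact nonempty_algEquiv_of_roots (sub_eq_zero.1 h) hq1 hrs.symm
end
end
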